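/- Let T₁, T₂ be completely positive maps X → B(H) and T = T₁ + T₂ with minimal Stinespring representation (π_T, K_T, V_T). If every completely positive T′ with T′ ≤ T₁ and T′ ≤ T₂ is zero, then the positive operator R ∈ π_T(X)′ with 0 ≤ R ≤ 1 and T₁ = V_T* R π_T(·) V_T (given by the Radon–Nikodym lemma) satisfies R(1−R) = 0, i.e. R is a projection. -/

import Mathlib

open scoped ComplexOrder InnerProductSpace

noncomputable section

/-- A matrix over a star ring is positive if it is of the form `Nᴴ * N`. -/
def MatPos {A : Type*} [Ring A] [StarRing A] {n : ℕ}
    (M : Matrix (Fin n) (Fin n) A) : Prop :=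
  ∃ N : Matrix (Fin n) (Fin n) A, M = N.conjTranspose * N

/-- `T` is completely positive if the induced entrywise maps on matrices are positive. -/
def CompletelyPositiveFun {A B : Type*} [Ring A] [StarRing A] [Ring B] [StarRing B]
    (T : A → B) : Prop :=
  ∀ (n : ℕ) (M : Matrix (Fin n) (Fin n) A), MatPos M → MatPos (M.map T)

/-- `(π, K, V)` is a Stinespring representation of `T : X → B(H)`:
`T x = V* (π x) V` for all `x`. -/
def IsStinespring {X : Type*} [NormedRing X] [StarRing X] [CStarRing X]
    [NormedAlgebra ℂ X] [StarModule ℂ X]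
    {H K : Type*} [NormedAddCommGroup H] [InnerProductSpace ℂ H] [CompleteSpace H]
    [NormedAddCommGroup K] [InnerProductSpace ℂ K] [CompleteSpace K]
    (T : X → (H →L[ℂ] H)) (π : X →⋆ₐ[ℂ] (K →L[ℂ] K)) (V : H →L[ℂ] K) : Prop :=
  ∀ x : X, T x = (ContinuousLinearMap.adjoint V).comp ((π x).comp V)

/-- Minimality: the closed linear span of `π(X) V H` is all of `K`. -/
def IsMinimalStinespring {X : Type*} [NormedRing X] [StarRing X] [CStarRing X]
    [NormedAlgebra ℂ X] [StarModule ℂ X]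
    {H K : Type*} [NormedAddCommGroup H] [InnerProductSpace ℂ H] [CompleteSpace H]
    [NormedAddCommGroup K] [InnerProductSpace ℂ K] [CompleteSpace K]
    (π : X →⋆ₐ[ℂ] (K →L[ℂ] K)) (V : H →L[ℂ] K) : Prop :=
  (Submodule.span ℂ {k : K | ∃ (x : X) (h : H), k = π x (V h)}).topologicalClosure = ⊤

open ContinuousLinearMap in
theorem adjoint_piLp_proj_apply {H ι : Type*} [NormedAddCommGroup H] [InnerProductSpace ℂ H]
    [CompleteSpace H] [Fintype ι] [DecidableEq ι] (i : ι) (a : H) :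
    adjoint (PiLp.proj (𝕜 := ℂ) 2 (fun _ : ι => H) i) a = PiLp.single 2 i a := by
  refine ext_inner_right ℂ fun y => ?_
  rw [adjoint_inner_left, PiLp.inner_apply, Finset.sum_eq_single i]
  · simp
  · intro j _ hj
    simp [hj]
  · simp

theorem ContinuousLinearMap.IsPositive.exists_eq_star_mul_self {E : Type*}
    [NormedAddCommGroup E] [InnerProductSpace ℂ E] [CompleteSpace E] {S : E →L[ℂ] E}
    (hS : S.IsPositive) : ∃ Q : E →L[ℂ] E, S = star Q * Q :=
  CStarAlgebra.nonneg_iff_eq_star_mul_self.mp (S.nonneg_iff_isPositive.mpr hS)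

/-- A matrix of operators on `H` whose associated operator on `Hⁿ` is positive is `MatPos`. -/
theorem matPos_of_isPositive {H : Type*} [NormedAddCommGroup H] [InnerProductSpace ℂ H]
    [CompleteSpace H] {n : ℕ} {M : Matrix (Fin n) (Fin n) (H →L[ℂ] H)}
    {S : PiLp 2 (fun _ : Fin n => H) →L[ℂ] PiLp 2 (fun _ : Fin n => H)} (hS : S.IsPositive)
    (hM : ∀ i j a b, ⟪a, M i j b⟫_ℂ = ⟪PiLp.single 2 i a, S (PiLp.single 2 j b)⟫_ℂ) :
    MatPos M := by
  obtain ⟨Q, rfl⟩ := hS.exists_eq_star_mul_self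
  let P := fun k : Fin n => PiLp.proj (𝕜 := ℂ) 2 (fun _ : Fin n => H) k
  refine ⟨Matrix.of fun k j => P k ∘L Q ∘L ContinuousLinearMap.adjoint (P j), ?_⟩
  ext i j b
  refine ext_inner_left ℂ fun a => ?_
  rw [hM, Matrix.mul_apply, sum_apply, inner_sum,
    mul_apply_eq_comp, ContinuousLinearMap.star_eq_adjoint,
    ContinuousLinearMap.adjoint_inner_right, PiLp.inner_apply]
  refine Finset.sum_congr rfl fun k _ => ?_
  rw [Matrix.conjTranspose_apply, mul_apply_eq_comp,
    ContinuousLinearMap.star_eq_adjoint, ContinuousLinearMap.adjoint_inner_right]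
  simp [P, adjoint_piLp_proj_apply]

/-- Compressing a representation by a positive operator of its commutant gives a completely
positive map. -/
theorem completelyPositiveFun_of_commutant {X : Type*} [Ring X] [StarRing X] [Algebra ℂ X]
    {H K : Type*} [NormedAddCommGroup H] [InnerProductSpace ℂ H] [CompleteSpace H]
    [NormedAddCommGroup K] [InnerProductSpace ℂ K] [CompleteSpace K]
    (π : X →⋆ₐ[ℂ] (K →L[ℂ] K)) (V : H →L[ℂ] K) {S : K →L[ℂ] K} (hS : S.IsPositive)
    (hcomm : ∀ x, S * π x = π x * S) {T : X → (H →L[ℂ] H)}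
    (hT : ∀ x, T x = ContinuousLinearMap.adjoint V ∘L S ∘L π x ∘L V) :
    CompletelyPositiveFun T := by
  rintro n _ ⟨N, rfl⟩
  let A : Fin n → PiLp 2 (fun _ : Fin n => H) →L[ℂ] K := fun k =>
    ∑ j, π (N k j) ∘L V ∘L PiLp.proj (𝕜 := ℂ) 2 (fun _ : Fin n => H) j
  have hA (k j : Fin n) (b : H) : A k (PiLp.single 2 j b) = π (N k j) (V b) := by
    simp only [A, sum_apply, ContinuousLinearMap.comp_apply,
      PiLp.proj_apply]
    rw [Finset.sum_eq_single j]
    · simp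
    · intro i _ hi
      simp [hi]
    · simp
  refine matPos_of_isPositive
    (S := ∑ k, ContinuousLinearMap.adjoint (A k) ∘L S ∘L A k)
    (ContinuousLinearMap.isPositive_sum _ fun k _ => hS.adjoint_conj (A k)) fun i j a b => ?_
  rw [Matrix.map_apply, hT, Matrix.mul_apply, map_sum, sum_apply, inner_sum]
  simp only [ContinuousLinearMap.comp_apply, ContinuousLinearMap.adjoint_inner_right,
    sum_apply, map_sum, inner_sum, hA]
  refine Finset.sum_congr rfl fun k _ => ?_
  rw [Matrix.conjTranspose_apply, ← mul_apply_eq_comp S, hcomm, map_mul, map_star,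
    mul_assoc, ← hcomm, mul_apply_eq_comp, ContinuousLinearMap.star_eq_adjoint,
    ContinuousLinearMap.adjoint_inner_right]
  rfl

/-- An operator of the commutant of a minimal representation is determined by its compression. -/
theorem IsMinimalStinespring.eq_zero_of_commutant {X : Type*} [NormedRing X] [StarRing X]
    [CStarRing X] [NormedAlgebra ℂ X] [StarModule ℂ X]
    {H K : Type*} [NormedAddCommGroup H] [InnerProductSpace ℂ H] [CompleteSpace H]
    [NormedAddCommGroup K] [InnerProductSpace ℂ K] [CompleteSpace K]
    {π : X →⋆ₐ[ℂ] (K →L[ℂ] K)} {V : H →L[ℂ] K} (hmin : IsMinimalStinespring π V)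
    {S : K →L[ℂ] K} (hcomm : ∀ x, S * π x = π x * S)
    (hS : ∀ x, ContinuousLinearMap.adjoint V ∘L S ∘L π x ∘L V = 0) : S = 0 := by
  have hd := Submodule.dense_iff_topologicalClosure_eq_top.mpr hmin
  refine ContinuousLinearMap.ext_on hd ?_
  rintro _ ⟨x, h, rfl⟩
  have hz : innerSL ℂ (S (π x (V h))) = 0 := by
    refine ContinuousLinearMap.ext_on hd ?_
    rintro _ ⟨y, g, rfl⟩
    have key := congrArg (fun F : H →L[ℂ] H => ⟪F h, g⟫_ℂ) (hS (star y * x))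
    simp only [ContinuousLinearMap.comp_apply, ContinuousLinearMap.adjoint_inner_left] at key
    rw [← mul_apply_eq_comp S, hcomm, map_mul, map_star, mul_assoc, ← hcomm,
      mul_apply_eq_comp, ContinuousLinearMap.star_eq_adjoint,
      ContinuousLinearMap.adjoint_inner_left] at key
    simpa using key
  have hzz := DFunLike.congr_fun hz (S (π x (V h)))
  simpa using hzz

theorem ContinuousLinearMap.IsPositive.mul_self {K : Type*} [NormedAddCommGroup K]
    [InnerProductSpace ℂ K] [CompleteSpace K] {R : K →L[ℂ] K} (hR : R.IsPositive) :
    (R * R).IsPositive := by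
  have h := (isPositive_one (𝕜 := ℂ) (E := K)).conj_adjoint R
  rw [hR.isSelfAdjoint.adjoint_eq] at h
  exact h

theorem ContinuousLinearMap.IsPositive.mul_one_sub {K : Type*} [NormedAddCommGroup K]
    [InnerProductSpace ℂ K] [CompleteSpace K] {R : K →L[ℂ] K} (hR : R.IsPositive)
    (hR' : (1 - R).IsPositive) : (R * (1 - R)).IsPositive := by
  have h := (hR'.conj_adjoint R).add (hR.conj_adjoint (1 - R))
  rw [hR.isSelfAdjoint.adjoint_eq, hR'.isSelfAdjoint.adjoint_eq] at h
  have e : R * (1 - R) = R * ((1 - R) * R) + (1 - R) * (R * (1 - R)) := by noncomm_ring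
  rw [e]
  exact h

/-- If `T = T₁ + T₂` and every CP map dominated by both `T₁` and `T₂` is zero, then the
Radon–Nikodym operator `R ∈ π(X)′`, `0 ≤ R ≤ 1`, with `T₁ = V* R π(·) V` satisfies
`R(1 − R) = 0`, i.e. `R` is a projection. -/
theorem radon_nikodym_projection_of_orthogonal
    {X : Type*} [NormedRing X] [StarRing X] [CStarRing X]
    [NormedAlgebra ℂ X] [StarModule ℂ X]
    {H K : Type*} [NormedAddCommGroup H] [InnerProductSpace ℂ H] [CompleteSpace H]
    [NormedAddCommGroup K] [InnerProductSpace ℂ K] [CompleteSpace K]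
    (T₁ T₂ : X →ₗ[ℂ] (H →L[ℂ] H))
    (hT₁ : CompletelyPositiveFun (⇑T₁)) (hT₂ : CompletelyPositiveFun (⇑T₂))
    (π : X →⋆ₐ[ℂ] (K →L[ℂ] K)) (V : H →L[ℂ] K)
    (hst : IsStinespring (fun x => T₁ x + T₂ x) π V) (hmin : IsMinimalStinespring π V)
    (horth : ∀ T' : X →ₗ[ℂ] (H →L[ℂ] H), CompletelyPositiveFun (⇑T') →
      CompletelyPositiveFun (fun x => T₁ x - T' x) →
      CompletelyPositiveFun (fun x => T₂ x - T' x) → T' = 0)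
    (R : K →L[ℂ] K)
    (hcomm : ∀ x : X, R * π x = π x * R)
    (hpos : R.IsPositive) (hle : (1 - R).IsPositive)
    (hR : ∀ x : X, T₁ x =
      (ContinuousLinearMap.adjoint V).comp (R.comp ((π x).comp V))) :
    R * (1 - R) = 0 := by
  have hcomm' (x : X) : Commute R (π x) := hcomm x
  have hcs (x : X) : Commute (1 - R) (π x) := (Commute.one_left _).sub_left (hcomm' x)
  have hT₂V (x : X) : T₂ x = ContinuousLinearMap.adjoint V ∘L (1 - R) ∘L π x ∘L V := by
    rw [eq_sub_of_add_eq' (hst x), hR]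
    ext h
    simp
  let T' : X →ₗ[ℂ] (H →L[ℂ] H) :=
    { toFun x := ContinuousLinearMap.adjoint V ∘L (R * (1 - R)) ∘L π x ∘L V
      map_add' x y := by ext h; simp
      map_smul' c x := by ext h; simp }
  have hT' (x : X) : T' x = ContinuousLinearMap.adjoint V ∘L (R * (1 - R)) ∘L π x ∘L V := rfl
  have hcommS (x : X) : R * (1 - R) * π x = π x * (R * (1 - R)) :=
    (hcomm' x).mul_left (hcs x)
  have hzero : T' = 0 := by
    refine horth T' ?_ ?_ ?_
    · exact completelyPositiveFun_of_commutant π V (hpos.mul_one_sub hle) hcommS hT'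
    · refine completelyPositiveFun_of_commutant π V hpos.mul_self
        (fun x => (hcomm' x).mul_left (hcomm' x)) fun x => ?_
      rw [hR, hT']
      ext h
      simp
    · refine completelyPositiveFun_of_commutant π V hle.mul_self
        (fun x => (hcs x).mul_left (hcs x)) fun x => ?_
      rw [hT₂V, hT']
      ext h
      simp
  refine hmin.eq_zero_of_commutant hcommS fun x => ?_
  rw [← hT', hzero, LinearMap.zero_apply]
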